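/- Let 1 ≤ p < ∞, 0 < γ < 1 and let v ∈ W^{1,p}_loc(ℝ^n) ∩ L^∞_loc(ℝ^n) with weak gradient Dv, and suppose Dv ∈ B^γ_{p,∞,loc}(ℝ^n). Then Dv ∈ L^{p(1+β)}_loc(ℝ^n) for every 0 < β < γ. Moreover, there exists C = C(n,p,γ,β) such that for all concentric balls B_ρ ⊂ B_R with 0 < ρ < R ≤ 1, ∫_{B_ρ} |Dv|^{p(1+β)} dx ≤ C ‖v‖^{pβ}_{L^∞(B_R)} ( [Dv]^p_{B^γ_{p,∞}(B_R)} + (R−ρ)^{−2p} ‖v‖^p_{W^{1,p}(B_R)} ), where [w]_{B^γ_{p,∞}(B_R)} := sup_{0<|h|<R} ( ∫_{B_R} |w(x+h) − w(x)|^p |h|^{−γp} dx )^{1/p}. -/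

import Mathlib

open MeasureTheory Metric Real Set Filter
open scoped Topology ENNReal

noncomputable section

/-- `n`-dimensional Euclidean space. -/
abbrev En (n : ℕ) := EuclideanSpace ℝ (Fin n)

/-- `Dv` is a weak gradient of `v` on the open set `U`. -/
def IsWeakGrad {n : ℕ} (U : Set (En n)) (v : En n → ℝ) (Dv : En n → En n) : Prop :=
  ∀ φ : En n → ℝ, ContDiff ℝ (⊤ : ℕ∞) φ → HasCompactSupport φ → tsupport φ ⊆ U →
    ∀ i : Fin n,
      ∫ x in U, v x * fderiv ℝ φ x (EuclideanSpace.single i (1 : ℝ)) =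
        - ∫ x in U, Dv x i * φ x

/-- Membership in `L^r(U)` (real exponent `r`, via finiteness of the `r`-energy). -/
def MemLpS {n : ℕ} {F : Type*} [NormedAddCommGroup F] (w : En n → F) (r : ℝ)
    (U : Set (En n)) : Prop :=
  AEStronglyMeasurable w (volume.restrict U) ∧ IntegrableOn (fun x => ‖w x‖ ^ r) U

/-- Membership in `L^r_loc(U)`. -/
def MemLplocS {n : ℕ} {F : Type*} [NormedAddCommGroup F] (w : En n → F) (r : ℝ)
    (U : Set (En n)) : Prop :=
  ∀ K ⊆ U, IsCompact K → MemLpS w r K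

/-- Membership in `L^∞_loc(U)`. -/
def MemLinftyLoc {n : ℕ} (w : En n → ℝ) (U : Set (En n)) : Prop :=
  ∀ K ⊆ U, IsCompact K → ∃ M : ℝ, ∀ᵐ x ∂volume.restrict K, |w x| ≤ M

/-- The local Besov space `B^α_{r,∞,loc}(U)`. -/
def MemBesovLocInfty {n : ℕ} {F : Type*} [NormedAddCommGroup F] (w : En n → F)
    (α r : ℝ) (U : Set (En n)) : Prop :=
  MemLplocS w r U ∧
    ∀ (x₀ : En n) (ρ : ℝ), 0 < ρ → ball x₀ (2 * ρ) ⊆ U →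
      ∃ M : ℝ, ∀ h : En n, h ≠ 0 → ‖h‖ < ρ →
        (∫ x in ball x₀ ρ, ‖w (x + h) - w x‖ ^ r / ‖h‖ ^ (α * r)) ≤ M

/-- The local Besov space `B^α_{r,σ,loc}(U)` with finite secondary exponent `σ`. -/
def MemBesovLocFin {n : ℕ} {F : Type*} [NormedAddCommGroup F] (w : En n → F)
    (α r σ : ℝ) (U : Set (En n)) : Prop :=
  MemLplocS w r U ∧
    ∀ (x₀ : En n) (ρ : ℝ), 0 < ρ → ball x₀ (2 * ρ) ⊆ U →
      IntegrableOn
        (fun h : En n =>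
          (∫ x in ball x₀ ρ, ‖w (x + h) - w x‖ ^ r / ‖h‖ ^ (α * r)) ^ (σ / r) / ‖h‖ ^ (n : ℝ))
        (ball (0 : En n) ρ)

/-- The auxiliary map `V_p(ξ) = (μ² + |ξ|²)^((p-2)/4) ξ`. -/
def Vp {n : ℕ} (p μ : ℝ) (ξ : En n) : En n := ((μ ^ 2 + ‖ξ‖ ^ 2) ^ ((p - 2) / 4)) • ξ

/-- Membership in the obstacle class `K_ψ(Ω)`, with explicit weak gradient `Dw`. -/
def MemK {n : ℕ} (Ω : Set (En n)) (ψ : En n → ℝ) (p : ℝ)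
    (w : En n → ℝ) (Dw : En n → En n) : Prop :=
  IsWeakGrad Ω w Dw ∧ MemLpS w p Ω ∧ MemLpS Dw p Ω ∧
    ∀ᵐ x ∂volume.restrict Ω, ψ x ≤ w x

/-- `u` (with weak gradient `Du`) solves the obstacle problem for the energy density `F`. -/
def SolvesObstacle {n : ℕ} (Ω : Set (En n)) (F : En n → En n → ℝ) (ψ : En n → ℝ) (p : ℝ)
    (u : En n → ℝ) (Du : En n → En n) : Prop :=
  MemK Ω ψ p u Du ∧
    ∀ w Dw, MemK Ω ψ p w Dw → ∫ x in Ω, F x (Du x) ≤ ∫ x in Ω, F x (Dw x)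

/-- The Besov seminorm `[w]_{B^γ_{r,∞}(B(x₀,R))}`. -/
def besovSemi {n : ℕ} {F : Type*} [NormedAddCommGroup F] (w : En n → F) (γ r : ℝ)
    (x₀ : En n) (R : ℝ) : ℝ :=
  sSup {t : ℝ | ∃ h : En n, h ≠ 0 ∧ ‖h‖ < R ∧
    t = (∫ x in ball x₀ R, ‖w (x + h) - w x‖ ^ r / ‖h‖ ^ (γ * r)) ^ (1 / r)}

/-- The `L^r` norm on a set. -/
def lpNormS {n : ℕ} {F : Type*} [NormedAddCommGroup F] (w : En n → F) (r : ℝ)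
    (S : Set (En n)) : ℝ :=
  (∫ x in S, ‖w x‖ ^ r) ^ (1 / r)

/-- The `W^{1,p}` norm on a set. -/
def normW1p {n : ℕ} (v : En n → ℝ) (Dv : En n → En n) (p : ℝ) (S : Set (En n)) : ℝ :=
  (∫ x in S, |v x| ^ p) ^ (1 / p) + (∫ x in S, ‖Dv x‖ ^ p) ^ (1 / p)


theorem lintegral_rpow_le_lintegral_rpow {α : Type*} [MeasurableSpace α] {ν : Measure α}
    [IsProbabilityMeasure ν] {p : ℝ} (hp : 1 ≤ p) {f : α → ℝ≥0∞} (hf : AEMeasurable f ν) :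
    (∫⁻ x, f x ∂ν) ^ p ≤ ∫⁻ x, f x ^ p ∂ν := by
  have h := eLpNorm'_le_eLpNorm'_of_exponent_le (μ := ν) one_pos hp hf.aestronglyMeasurable
  simp only [eLpNorm', enorm_eq_self, ENNReal.rpow_one, div_one] at h
  rwa [one_div, ENNReal.le_rpow_inv_iff (by linarith)] at h

theorem lintegral_norm_sub_average_rpow_le {n : ℕ} {f : En n → En n}
    (hf : AEStronglyMeasurable f volume) {ν : Measure (En n)} [IsProbabilityMeasure ν]
    {p : ℝ} (hp : 1 ≤ p) {ε : ℝ} (hint : ∀ x, Integrable (fun z => f (x + ε • z)) ν)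
    (B : Set (En n)) {K : ℝ≥0∞}
    (hK : ∀ᵐ z ∂ν, ∫⁻ x in B, ‖f (x + ε • z) - f x‖ₑ ^ p ≤ K) :
    ∫⁻ x in B, ‖f x - ∫ z, f (x + ε • z) ∂ν‖ₑ ^ p ≤ K := by
  have hqmp : Measure.QuasiMeasurePreserving (fun q : En n × En n => q.1 + ε • q.2)
      ((volume.restrict B).prod ν) volume := by
    refine QuasiMeasurePreserving.prod_of_left (by fun_prop) (ae_of_all _ fun z => ?_)
    exact (measurePreserving_add_right volume (ε • z)).quasiMeasurePreserving.mono_left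
      Measure.restrict_le_self.absolutelyContinuous
  have hmeas : AEMeasurable (fun q : En n × En n => ‖f (q.1 + ε • q.2) - f q.1‖ₑ ^ p)
      ((volume.restrict B).prod ν) :=
    ((hf.comp_quasiMeasurePreserving hqmp).sub hf.restrict.comp_fst).enorm.pow_const p
  calc ∫⁻ x in B, ‖f x - ∫ z, f (x + ε • z) ∂ν‖ₑ ^ p
      ≤ ∫⁻ x in B, ∫⁻ z, ‖f (x + ε • z) - f x‖ₑ ^ p ∂ν := by
        refine lintegral_mono fun x => ?_
        have h1 : f x - ∫ z, f (x + ε • z) ∂ν = - ∫ z, (f (x + ε • z) - f x) ∂ν := by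
          rw [integral_sub (hint x) (integrable_const _)]
          simp
        rw [h1, enorm_neg]
        refine (ENNReal.rpow_le_rpow (enorm_integral_le_lintegral_enorm _) (by linarith)).trans ?_
        exact lintegral_rpow_le_lintegral_rpow hp
          ((hint x).1.sub aestronglyMeasurable_const).enorm
    _ = ∫⁻ z, (∫⁻ x in B, ‖f (x + ε • z) - f x‖ₑ ^ p) ∂ν := lintegral_lintegral_swap hmeas
    _ ≤ ∫⁻ _, K ∂ν := lintegral_mono_ae hK
    _ = K := by simp

theorem tsupport_comp_inv_smul_sub_subset {n : ℕ} {η : En n → ℝ}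
    (hs : tsupport η ⊆ closedBall 0 1) (x : En n) {ε : ℝ} (hε : 0 < ε) :
    tsupport (fun y => η (ε⁻¹ • (y - x))) ⊆ closedBall x ε := by
  refine closure_minimal (fun y hy => ?_) isClosed_closedBall
  have := hs (subset_tsupport _ (show ε⁻¹ • (y - x) ∈ Function.support η from hy))
  rw [mem_closedBall_zero_iff, norm_smul, norm_inv, Real.norm_of_nonneg hε.le,
    inv_mul_le_iff₀ hε, mul_one] at this
  rwa [mem_closedBall_iff_norm]

theorem MeasureTheory.LocallyIntegrable.integrable_smul_comp_add_smul {n : ℕ}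
    {f : En n → En n} (hf : LocallyIntegrable f volume) {η : En n → ℝ} (hη : Continuous η)
    (hs : tsupport η ⊆ closedBall 0 1) (x : En n) {ε : ℝ} (hε : 0 < ε) :
    Integrable (fun z => η z • f (x + ε • z)) := by
  have h1 : Integrable (fun y => η (ε⁻¹ • (y - x)) • f y) :=
    hf.integrable_smul_left_of_hasCompactSupport (by fun_prop)
      ((isCompact_closedBall x ε).of_isClosed_subset (isClosed_tsupport _)
        (tsupport_comp_inv_smul_sub_subset hs x hε))
  simpa [smul_smul, hε.ne'] using (h1.comp_add_left x).comp_smul hε.ne'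

theorem norm_integral_smul_le_of_isWeakGrad {n : ℕ} {v : En n → ℝ} {Dv : En n → En n}
    (hw : IsWeakGrad Set.univ v Dv) (hDv : LocallyIntegrable Dv volume)
    {η : En n → ℝ} (hη : ContDiff ℝ (⊤ : ℕ∞) η) (hs : tsupport η ⊆ closedBall 0 1)
    {x : En n} {ε M : ℝ} (hε : 0 < ε)
    (hM : ∀ᵐ y : En n, y ∈ closedBall x ε → |v y| ≤ M) :
    ‖∫ z, η z • Dv (x + ε • z)‖ ≤
      M / ε * ∑ i : Fin n, ∫ z, |fderiv ℝ η z (EuclideanSpace.single i (1 : ℝ))| := by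
  set φ : En n → ℝ := fun y => η (ε⁻¹ • (y - x)) with hφ
  have hφd : ContDiff ℝ (⊤ : ℕ∞) φ := hη.comp (by fun_prop)
  have hφz (z : En n) : φ (x + ε • z) = η z := by simp [hφ, smul_smul, hε.ne']
  have hφs : tsupport φ ⊆ closedBall x ε := tsupport_comp_inv_smul_sub_subset hs x hε
  have hφc : HasCompactSupport φ :=
    (isCompact_closedBall x ε).of_isClosed_subset (isClosed_tsupport _) hφs
  have hderiv (y e : En n) : fderiv ℝ φ y e = ε⁻¹ * fderiv ℝ η (ε⁻¹ • (y - x)) e := by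
    have h1 : HasFDerivAt (fun y : En n => ε⁻¹ • (y - x))
        (ε⁻¹ • ContinuousLinearMap.id ℝ (En n)) y :=
      ((hasFDerivAt_id y).sub_const x).const_smul ε⁻¹
    have h2 := ((hη.differentiable (by simp)) (ε⁻¹ • (y - x))).hasFDerivAt.comp y h1
    rw [show fderiv ℝ φ y = _ from h2.fderiv]
    simp
  have hcv {F : Type} [NormedAddCommGroup F] [NormedSpace ℝ F] (g : En n → F) :
      ∫ z, g (x + ε • z) = (ε ^ n)⁻¹ • ∫ y, g y := by
    rw [Measure.integral_comp_smul volume (fun z => g (x + z)) ε,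
      integral_add_left_eq_self g x, abs_of_nonneg (by positivity)]
    simp
  have hint : Integrable (fun z => η z • Dv (x + ε • z)) :=
    hDv.integrable_smul_comp_add_smul hη.continuous hs x hε
  have hcomp (i : Fin n) : |(∫ z, η z • Dv (x + ε • z)) i| ≤
      M / ε * ∫ z, |fderiv ℝ η z (EuclideanSpace.single i (1 : ℝ))| := by
    have h1 : (∫ z, η z • Dv (x + ε • z)) i = ∫ z, Dv (x + ε • z) i * φ (x + ε • z) := by
      have := (EuclideanSpace.proj (𝕜 := ℝ) i).integral_comp_comm hint
      simp only [PiLp.proj_apply, PiLp.smul_apply, smul_eq_mul] at this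
      rw [← this]
      simp only [hφz, mul_comm]
    have h2 := hw φ hφd hφc (subset_univ _) i
    simp only [setIntegral_univ] at h2
    have hdc : Continuous fun y => fderiv ℝ φ y (EuclideanSpace.single i (1 : ℝ)) :=
      (hφd.continuous_fderiv (by simp)).clm_apply continuous_const
    have hdi : Integrable fun y => M * |fderiv ℝ φ y (EuclideanSpace.single i (1 : ℝ))| :=
      ((hdc.integrable_of_hasCompactSupport (hφc.fderiv_apply ℝ _)).abs).const_mul M
    have h3 : |∫ y, v y * fderiv ℝ φ y (EuclideanSpace.single i (1 : ℝ))| ≤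
        ∫ y, M * |fderiv ℝ φ y (EuclideanSpace.single i (1 : ℝ))| := by
      rw [← Real.norm_eq_abs]
      refine norm_integral_le_of_norm_le hdi ?_
      filter_upwards [hM] with y hy
      rw [norm_mul, Real.norm_eq_abs, Real.norm_eq_abs]
      by_cases hyb : y ∈ closedBall x ε
      · exact mul_le_mul_of_nonneg_right (hy hyb) (abs_nonneg _)
      · have : fderiv ℝ φ y = 0 :=
          image_eq_zero_of_notMem_tsupport fun h => hyb (hφs (tsupport_fderiv_subset ℝ h))
        simp [this]
    rw [h1, hcv (fun y => Dv y i * φ y), ← neg_eq_iff_eq_neg.mpr h2, smul_eq_mul, mul_neg, abs_neg,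
      abs_mul, abs_of_nonneg (by positivity)]
    refine (mul_le_mul_of_nonneg_left h3 (by positivity)).trans_eq ?_
    rw [← smul_eq_mul, ← hcv (fun y => M * |fderiv ℝ φ y (EuclideanSpace.single i (1 : ℝ))|)]
    rw [← integral_const_mul]
    congr 1 with z
    rw [hderiv, add_sub_cancel_left, smul_smul, inv_mul_cancel₀ hε.ne', one_smul, abs_mul,
      abs_of_pos (inv_pos.mpr hε)]
    ring
  rw [Finset.mul_sum]
  refine le_trans ?_ (Finset.sum_le_sum fun i _ => hcomp i)
  set w := ∫ z, η z • Dv (x + ε • z)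
  rw [EuclideanSpace.norm_eq]
  refine Real.sqrt_le_iff.mpr ⟨Finset.sum_nonneg fun i _ => abs_nonneg _, ?_⟩
  simpa using Finset.sum_sq_le_sq_sum_of_nonneg (s := Finset.univ) (f := fun i => |w i|)
    fun i _ => abs_nonneg _

theorem lintegral_rpow_add_le_of_tail {α : Type*} [MeasurableSpace α] {μ : Measure α}
    {g : α → ℝ} (hg0 : ∀ x, 0 ≤ g x) (hg : AEMeasurable g μ) {p q s t₀ K : ℝ}
    (hp : 0 < p) (hq : 0 < q) (hqs : q < s) (ht₀ : 0 < t₀) (hK : 0 ≤ K)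
    (htail : ∀ t, t₀ < t →
      ∫⁻ x in {x | t < g x}, ENNReal.ofReal (g x ^ p) ∂μ ≤ ENNReal.ofReal (K * t ^ (-s))) :
    ∫⁻ x, ENNReal.ofReal (g x ^ (p + q)) ∂μ ≤
      ENNReal.ofReal (t₀ ^ q) * ∫⁻ x, ENNReal.ofReal (g x ^ p) ∂μ +
        ENNReal.ofReal (q * K * t₀ ^ (q - s) / (s - q)) := by
  set W : α → ℝ≥0∞ := fun x => ENNReal.ofReal (g x ^ p) with hW
  have hWm : AEMeasurable W μ := (hg.pow_const p).ennreal_ofReal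
  set κ := μ.withDensity W with hκ
  have hgκ : AEMeasurable g κ := hg.mono_ac (withDensity_absolutelyContinuous _ _)
  have hlt (t : ℝ) : κ {x | t < g x} = ∫⁻ x in {x | t < g x}, W x ∂μ :=
    withDensity_apply₀ _ (nullMeasurableSet_lt aemeasurable_const hg)
  have huniv (t : ℝ) : κ {x | t < g x} ≤ ∫⁻ x, W x ∂μ :=
    (hlt t).trans_le (setLIntegral_le_lintegral _ _)
  have hlhs : ∫⁻ x, ENNReal.ofReal (g x ^ (p + q)) ∂μ = ∫⁻ x, ENNReal.ofReal (g x ^ q) ∂κ := by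
    rw [hκ, lintegral_withDensity_eq_lintegral_mul₀ hWm (hg.pow_const q).ennreal_ofReal]
    refine lintegral_congr fun x => ?_
    rw [Pi.mul_apply, ← ENNReal.ofReal_mul (by have := hg0 x; positivity),
      Real.rpow_add_of_nonneg (hg0 x) hp.le hq.le]
  rw [hlhs, lintegral_rpow_eq_lintegral_meas_lt_mul κ (ae_of_all _ hg0) hgκ hq,
    ← Ioc_union_Ioi_eq_Ioi ht₀.le,
    lintegral_union measurableSet_Ioi (Ioc_disjoint_Ioi le_rfl), mul_add]
  gcongr ?_ + ?_
  · calc ENNReal.ofReal q *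
          ∫⁻ t in Ioc 0 t₀, κ {x | t < g x} * ENNReal.ofReal (t ^ (q - 1))
        ≤ ENNReal.ofReal q *
          ∫⁻ t in Ioc 0 t₀, (∫⁻ x, W x ∂μ) * ENNReal.ofReal (t ^ (q - 1)) := by
          gcongr; exact huniv _
      _ = ENNReal.ofReal (t₀ ^ q) * ∫⁻ x, W x ∂μ := by
          have hi : IntegrableOn (fun t : ℝ => t ^ (q - 1)) (Ioc 0 t₀) :=
            (intervalIntegrable_iff_integrableOn_Ioc_of_le ht₀.le).mp
              (intervalIntegral.intervalIntegrable_rpow' (by linarith))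
          rw [lintegral_const_mul _ (by fun_prop),
            ← ofReal_integral_eq_lintegral_ofReal hi
              ((ae_restrict_mem measurableSet_Ioc).mono fun t ht => Real.rpow_nonneg ht.1.le _),
            ← intervalIntegral.integral_of_le ht₀.le, integral_rpow (Or.inl (by linarith)),
            mul_left_comm, ← ENNReal.ofReal_mul hq.le, mul_comm]
          congr 2
          rw [sub_add_cancel, Real.zero_rpow hq.ne']
          field_simp
          ring
  · calc ENNReal.ofReal q *
          ∫⁻ t in Ioi t₀, κ {x | t < g x} * ENNReal.ofReal (t ^ (q - 1))
        ≤ ENNReal.ofReal q * ∫⁻ t in Ioi t₀, ENNReal.ofReal (K * t ^ (q - s - 1)) := by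
          gcongr 1
          refine setLIntegral_mono' measurableSet_Ioi fun t ht => ?_
          have ht0 : 0 < t := ht₀.trans ht
          rw [hlt]
          refine (mul_le_mul_left (htail t ht) _).trans_eq ?_
          rw [← ENNReal.ofReal_mul (by positivity), mul_assoc, ← Real.rpow_add ht0]
          ring_nf
      _ = ENNReal.ofReal (q * K * t₀ ^ (q - s) / (s - q)) := by
          have hi : IntegrableOn (fun t : ℝ => K * t ^ (q - s - 1)) (Ioi t₀) :=
            (integrableOn_Ioi_rpow_of_lt (by linarith) ht₀).const_mul K
          rw [← ofReal_integral_eq_lintegral_ofReal hi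
              ((ae_restrict_mem measurableSet_Ioi).mono fun t ht =>
                mul_nonneg hK (Real.rpow_nonneg (ht₀.trans ht).le _)),
            integral_const_mul, integral_Ioi_rpow_of_lt (by linarith) ht₀,
            ← ENNReal.ofReal_mul hq.le]
          congr 1
          have h1 : s - q ≠ 0 := by linarith
          have h2 : q - s ≠ 0 := by linarith
          rw [sub_add_cancel, ← neg_sub s q, neg_div_neg_eq]
          ring

theorem MemLplocS.memLp {n : ℕ} {F : Type*} [NormedAddCommGroup F] {w : En n → F} {r : ℝ}
    (hw : MemLplocS w r univ) (hr : 0 < r) {K : Set (En n)} (hK : IsCompact K) :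
    MemLp w (ENNReal.ofReal r) (volume.restrict K) := by
  obtain ⟨h1, h2⟩ := hw K (subset_univ _) hK
  rw [← integrable_norm_rpow_iff h1 (by simpa using hr) ENNReal.ofReal_ne_top,
    ENNReal.toReal_ofReal hr.le]
  exact h2

theorem MemLplocS.locallyIntegrable {n : ℕ} {F : Type*} [NormedAddCommGroup F] {w : En n → F}
    {r : ℝ} (hw : MemLplocS w r univ) (hr : 1 ≤ r) : LocallyIntegrable w volume := by
  rw [locallyIntegrable_iff]
  intro K hK
  have : IsFiniteMeasure (volume.restrict K) := ⟨by simpa using hK.measure_lt_top⟩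
  exact (hw.memLp (by linarith) hK).integrable (by simpa using hr)

theorem MemLplocS.integrableOn_norm_sub_rpow {n : ℕ} {F : Type*} [NormedAddCommGroup F]
    {w : En n → F} {r : ℝ} (hw : MemLplocS w r univ) (hr : 0 < r) (x₀ h : En n) (R : ℝ) :
    IntegrableOn (fun x => ‖w (x + h) - w x‖ ^ r) (ball x₀ R) := by
  set K := closedBall x₀ (R + ‖h‖)
  have h1 : MemLp (K.indicator w) (ENNReal.ofReal r) volume :=
    (memLp_indicator_iff_restrict isClosed_closedBall.measurableSet).mpr
      (hw.memLp hr (isCompact_closedBall _ _))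
  have h2 : MemLp (fun x => K.indicator w (x + h)) (ENNReal.ofReal r) volume :=
    h1.comp_measurePreserving (measurePreserving_add_right volume h)
  have h3 := (h2.sub h1).integrable_norm_rpow (by simpa using hr) ENNReal.ofReal_ne_top
  rw [ENNReal.toReal_ofReal hr.le] at h3
  refine h3.integrableOn.congr_fun (fun x hx => ?_) measurableSet_ball
  have hx' : ‖x - x₀‖ < R := mem_ball_iff_norm.mp hx
  have hm1 : x ∈ K := mem_closedBall_iff_norm.mpr (by linarith [norm_nonneg h])
  have hm2 : x + h ∈ K := by
    refine mem_closedBall_iff_norm.mpr ?_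
    rw [add_sub_right_comm]
    linarith [norm_add_le (x - x₀) h]
  simp [hm1, hm2]

theorem besovSemi_nonneg {n : ℕ} {F : Type*} [NormedAddCommGroup F] (w : En n → F) (γ r : ℝ)
    (x₀ : En n) (R : ℝ) : 0 ≤ besovSemi w γ r x₀ R := by
  refine Real.sSup_nonneg ?_
  rintro t ⟨h, -, -, rfl⟩
  positivity

theorem MemBesovLocInfty.lintegral_enorm_sub_rpow_le {n : ℕ} {F : Type*}
    [NormedAddCommGroup F] {w : En n → F} {γ r : ℝ} (hw : MemBesovLocInfty w γ r univ)
    (hr : 0 < r) (x₀ : En n) {R : ℝ} {h : En n} (hh : ‖h‖ < R) :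
    ∫⁻ x in ball x₀ R, ‖w (x + h) - w x‖ₑ ^ r ≤
      ENNReal.ofReal (‖h‖ ^ (γ * r) * besovSemi w γ r x₀ R ^ r) := by
  rcases eq_or_ne h 0 with rfl | h0
  · simp [hr]
  have hpos : 0 < ‖h‖ ^ (γ * r) := Real.rpow_pos_of_pos (norm_pos_iff.mpr h0) _
  have hbdd : BddAbove {t : ℝ | ∃ h : En n, h ≠ 0 ∧ ‖h‖ < R ∧
      t = (∫ x in ball x₀ R, ‖w (x + h) - w x‖ ^ r / ‖h‖ ^ (γ * r)) ^ (1 / r)} := by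
    obtain ⟨M, hM⟩ := hw.2 x₀ R ((norm_nonneg h).trans_lt hh) (subset_univ _)
    refine ⟨M ^ (1 / r), ?_⟩
    rintro t ⟨k, hk0, hk, rfl⟩
    exact Real.rpow_le_rpow (by positivity) (hM k hk0 hk) (by positivity)
  have hle := le_csSup hbdd ⟨h, h0, hh, rfl⟩
  change _ ≤ besovSemi w γ r x₀ R at hle
  rw [one_div, Real.rpow_inv_le_iff_of_pos (by positivity) (besovSemi_nonneg ..) hr,
    integral_div, div_le_iff₀ hpos, mul_comm] at hle
  refine le_trans (le_of_eq ?_) (ENNReal.ofReal_le_ofReal hle)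
  rw [ofReal_integral_eq_lintegral_ofReal (hw.1.integrableOn_norm_sub_rpow hr x₀ h R)
    (ae_of_all _ fun x => by positivity)]
  refine lintegral_congr fun x => ?_
  rw [← ofReal_norm, ENNReal.ofReal_rpow_of_nonneg (norm_nonneg _) hr.le]

theorem exists_lintegral_norm_rpow_tail_le (n : ℕ) : ∃ T : ℝ, 0 < T ∧
    ∀ {p s : ℝ}, 1 ≤ p → 0 ≤ s → ∀ {v : En n → ℝ} {Dv : En n → En n},
      IsWeakGrad univ v Dv → LocallyIntegrable Dv volume →
      ∀ {x₀ : En n} {ρ R S M : ℝ}, ρ < R → 0 ≤ S → 0 < M →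
        (∀ᵐ y : En n, y ∈ ball x₀ R → |v y| ≤ M) →
        (∀ h : En n, ‖h‖ ≤ R - ρ →
          ∫⁻ x in ball x₀ ρ, ‖Dv (x + h) - Dv x‖ₑ ^ p ≤ ENNReal.ofReal (‖h‖ ^ s * S)) →
        ∀ t, T * M / (R - ρ) < t →
          ∫⁻ x in {x | t < ‖Dv x‖}, ENNReal.ofReal (‖Dv x‖ ^ p) ∂(volume.restrict (ball x₀ ρ)) ≤
            ENNReal.ofReal (2 ^ p * (T * M) ^ s * S * t ^ (-s)) := by
  let b : ContDiffBump (0 : En n) := ⟨1 / 2, 1, by norm_num, by norm_num⟩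
  set η : En n → ℝ := b.normed volume with hη
  have hηd : ContDiff ℝ (⊤ : ℕ∞) η := b.contDiff_normed
  have hηs : tsupport η ⊆ closedBall 0 1 := b.tsupport_normed_eq.subset
  have hη0 (z : En n) : 0 ≤ η z := b.nonneg_normed z
  have hηm : Measurable fun z => ENNReal.ofReal (η z) := hηd.continuous.measurable.ennreal_ofReal
  set ν : Measure (En n) := volume.withDensity fun z => ENNReal.ofReal (η z) with hν
  have hprob : IsProbabilityMeasure ν := by
    refine ⟨?_⟩
    rw [hν, withDensity_apply _ MeasurableSet.univ, setLIntegral_univ,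
      ← ofReal_integral_eq_lintegral_ofReal b.integrable_normed (ae_of_all _ hη0),
      b.integral_normed, ENNReal.ofReal_one]
  have hν1 : ∀ᵐ z ∂ν, ‖z‖ ≤ 1 := by
    rw [hν, ae_withDensity_iff hηm]
    refine ae_of_all _ fun z hz => mem_closedBall_zero_iff.mp (hηs (subset_tsupport _ fun h => ?_))
    simp [h] at hz
  set c : ℝ := ∑ i : Fin n, ∫ z, |fderiv ℝ η z (EuclideanSpace.single i (1 : ℝ))| with hc
  have hc0 : 0 ≤ c := Finset.sum_nonneg fun i _ => by positivity
  refine ⟨2 * (c + 1), by positivity, ?_⟩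
  intro p s hp hs v Dv hw hDv x₀ ρ R S M hρR hS hM hv hosc t ht
  have hd : 0 < R - ρ := sub_pos.mpr hρR
  have hTM : 0 < 2 * (c + 1) * M := by positivity
  have ht0 : 0 < t := lt_trans (by positivity) ht
  set ε : ℝ := 2 * (c + 1) * M / t with hε
  have hε0 : 0 < ε := by positivity
  have hεd : ε ≤ R - ρ := by
    rw [div_lt_iff₀ hd] at ht
    rw [hε, div_le_iff₀ ht0]
    linarith
  have hint (x : En n) : Integrable (fun z => Dv (x + ε • z)) ν := by
    rw [hν, integrable_withDensity_iff_integrable_smul' hηm (ae_of_all _ fun _ => by simp)]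
    simpa only [ENNReal.toReal_ofReal (hη0 _)] using
      hDv.integrable_smul_comp_add_smul hηd.continuous hηs x hε0
  have havg (x : En n) (hx : x ∈ ball x₀ ρ) : ‖∫ z, Dv (x + ε • z) ∂ν‖ ≤ t / 2 := by
    rw [hν, integral_withDensity_eq_integral_toReal_smul hηm (ae_of_all _ fun _ => by simp)]
    simp only [ENNReal.toReal_ofReal (hη0 _)]
    refine (norm_integral_smul_le_of_isWeakGrad hw hDv hηd hηs hε0 (M := M) ?_).trans ?_
    · filter_upwards [hv] with y hy hyx
      refine hy (mem_ball.mpr ?_)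
      linarith [dist_triangle y x x₀, mem_closedBall.mp hyx, mem_ball.mp hx]
    · rw [← hc, div_mul_eq_mul_div, div_le_iff₀ hε0, hε]
      field_simp
      nlinarith
  have hosc' : ∀ᵐ z ∂ν, ∫⁻ x in ball x₀ ρ, ‖Dv (x + ε • z) - Dv x‖ₑ ^ p ≤
      ENNReal.ofReal (ε ^ s * S) := by
    filter_upwards [hν1] with z hz
    have hεz : ‖ε • z‖ ≤ ε := by
      rw [norm_smul, Real.norm_of_nonneg hε0.le]
      exact mul_le_of_le_one_right hε0.le hz
    refine (hosc _ (hεz.trans hεd)).trans (ENNReal.ofReal_le_ofReal ?_)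
    gcongr
  have hkey := lintegral_norm_sub_average_rpow_le hDv.aestronglyMeasurable hp hint
    (ball x₀ ρ) hosc'
  have hmeas : AEStronglyMeasurable Dv (volume.restrict (ball x₀ ρ)) :=
    hDv.aestronglyMeasurable.restrict
  have hnull : NullMeasurableSet {x | t < ‖Dv x‖} (volume.restrict (ball x₀ ρ)) :=
    nullMeasurableSet_lt aemeasurable_const hmeas.norm.aemeasurable
  calc ∫⁻ x in {x | t < ‖Dv x‖}, ENNReal.ofReal (‖Dv x‖ ^ p) ∂(volume.restrict (ball x₀ ρ))
      ≤ ∫⁻ x in {x | t < ‖Dv x‖}, ENNReal.ofReal (2 ^ p) *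
          ‖Dv x - ∫ z, Dv (x + ε • z) ∂ν‖ₑ ^ p ∂(volume.restrict (ball x₀ ρ)) := by
        refine lintegral_mono_ae ?_
        filter_upwards [ae_restrict_mem₀ hnull,
          ae_restrict_of_ae (ae_restrict_mem measurableSet_ball)]
          with x hx hxB
        rw [← ofReal_norm, ENNReal.ofReal_rpow_of_nonneg (norm_nonneg _) (by linarith),
          ← ENNReal.ofReal_mul (by positivity), ← Real.mul_rpow (by norm_num) (norm_nonneg _)]
        refine ENNReal.ofReal_le_ofReal (Real.rpow_le_rpow (norm_nonneg _) ?_ (by linarith))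
        have h1 := norm_sub_norm_le (Dv x) (∫ z, Dv (x + ε • z) ∂ν)
        have h2 := havg x hxB
        have h3 : t < ‖Dv x‖ := hx
        linarith
    _ ≤ ∫⁻ x in ball x₀ ρ, ENNReal.ofReal (2 ^ p) * ‖Dv x - ∫ z, Dv (x + ε • z) ∂ν‖ₑ ^ p :=
        setLIntegral_le_lintegral _ _
    _ ≤ ENNReal.ofReal (2 ^ p) * ENNReal.ofReal (ε ^ s * S) := by
        rw [lintegral_const_mul' _ _ ENNReal.ofReal_ne_top]
        gcongr
    _ = ENNReal.ofReal (2 ^ p * (2 * (c + 1) * M) ^ s * S * t ^ (-s)) := by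
        rw [← ENNReal.ofReal_mul (by positivity), hε, Real.div_rpow hTM.le ht0.le,
          Real.rpow_neg ht0.le]
        congr 1
        ring

theorem ae_abs_le_essSup_of_memLinftyLoc {n : ℕ} {v : En n → ℝ} (hv : MemLinftyLoc v univ)
    (x₀ : En n) (R : ℝ) :
    ∀ᵐ y ∂volume.restrict (ball x₀ R),
      |v y| ≤ essSup (fun x => |v x|) (volume.restrict (ball x₀ R)) := by
  obtain ⟨M, hM⟩ := hv (closedBall x₀ R) (subset_univ _) (isCompact_closedBall _ _)
  exact ae_le_essSup ⟨M, ae_restrict_of_ae_restrict_of_subset ball_subset_closedBall hM⟩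

theorem rpow_scaling_le {p q s T M d S N : ℝ} (hq : 0 < q) (hqs : q < s)
    (hqp : q ≤ 2 * p) (hT : 0 < T) (hM : 0 < M) (hd : 0 < d) (hd1 : d ≤ 1) (hS : 0 ≤ S)
    (hN : 0 ≤ N) :
    (T * M / d) ^ q * N + q * (2 ^ p * (T * M) ^ s * S) * (T * M / d) ^ (q - s) / (s - q) ≤
      T ^ q * (1 + q * 2 ^ p / (s - q)) * M ^ q * (S + (d ^ (2 * p))⁻¹ * N) := by
  have hTM : 0 < T * M := mul_pos hT hM
  have hsq : 0 < s - q := sub_pos.mpr hqs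
  have hA : (T * M / d) ^ q ≤ T ^ q * M ^ q * (d ^ (2 * p))⁻¹ := by
    rw [Real.div_rpow hTM.le hd.le, Real.mul_rpow hT.le hM.le, div_eq_mul_inv]
    gcongr ?_ * ?_
    exact inv_anti₀ (by positivity) (Real.rpow_le_rpow_of_exponent_ge hd hd1 hqp)
  have hB : (T * M) ^ s * (T * M / d) ^ (q - s) ≤ T ^ q * M ^ q := by
    rw [Real.div_rpow hTM.le hd.le, ← mul_div_assoc, ← Real.rpow_add hTM, div_eq_mul_inv,
      ← Real.rpow_neg hd.le, neg_sub, add_sub_cancel, Real.mul_rpow hT.le hM.le]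
    exact mul_le_of_le_one_right (by positivity) (Real.rpow_le_one hd.le hd1 hsq.le)
  have hD : 0 ≤ q * 2 ^ p / (s - q) := by positivity
  have hd2 : 0 ≤ (d ^ (2 * p))⁻¹ * N := by positivity
  have hTMq : 0 ≤ T ^ q * M ^ q := by positivity
  calc _ = (T * M / d) ^ q * N +
        q * 2 ^ p / (s - q) * ((T * M) ^ s * (T * M / d) ^ (q - s)) * S := by ring
    _ ≤ T ^ q * M ^ q * (d ^ (2 * p))⁻¹ * N + q * 2 ^ p / (s - q) * (T ^ q * M ^ q) * S := by
        gcongr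
    _ ≤ _ := by
        have h1 := mul_nonneg hTMq hS
        have h2 := mul_nonneg hTMq (mul_nonneg hD hd2)
        nlinarith

theorem lintegral_norm_rpow_le_normW1p_rpow {n : ℕ} {p : ℝ} (hp : 0 < p) {v : En n → ℝ}
    {Dv : En n → En n} (hDv : MemLplocS Dv p univ) (x₀ : En n) (R : ℝ) :
    ∫⁻ x in ball x₀ R, ENNReal.ofReal (‖Dv x‖ ^ p) ≤
      ENNReal.ofReal (normW1p v Dv p (ball x₀ R) ^ p) := by
  have hi : IntegrableOn (fun x => ‖Dv x‖ ^ p) (ball x₀ R) :=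
    (hDv _ (subset_univ _) (isCompact_closedBall x₀ R)).2.mono_set ball_subset_closedBall
  rw [← ofReal_integral_eq_lintegral_ofReal hi (ae_of_all _ fun x => by positivity)]
  refine ENNReal.ofReal_le_ofReal ?_
  rw [← Real.rpow_inv_le_iff_of_pos (by positivity) (by unfold normW1p; positivity) hp,
    ← one_div]
  exact le_add_of_nonneg_left (by positivity)

theorem exists_lintegral_norm_rpow_le (n : ℕ) {p γ β : ℝ} (hp : 1 ≤ p) (hγ1 : γ < 1)
    (hβ0 : 0 < β) (hβγ : β < γ) :
    ∃ C : ℝ, 0 < C ∧ ∀ {v : En n → ℝ} {Dv : En n → En n},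
      IsWeakGrad univ v Dv → MemLinftyLoc v univ → MemBesovLocInfty Dv γ p univ →
      ∀ (x₀ : En n) {ρ R : ℝ}, 0 < ρ → ρ < R → R ≤ 1 →
        0 ≤ essSup (fun x => |v x|) (volume.restrict (ball x₀ R)) ∧
        ∫⁻ x in ball x₀ ρ, ENNReal.ofReal (‖Dv x‖ ^ (p * (1 + β))) ≤
          ENNReal.ofReal (C * essSup (fun x => |v x|) (volume.restrict (ball x₀ R)) ^ (p * β) *
            (besovSemi Dv γ p x₀ R ^ p +
              ((R - ρ) ^ (2 * p))⁻¹ * normW1p v Dv p (ball x₀ R) ^ p)) := by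
  obtain ⟨T, hT, htail⟩ := exists_lintegral_norm_rpow_tail_le n
  have hp0 : 0 < p := by linarith
  have hγ0 : 0 < γ := hβ0.trans hβγ
  have hq : 0 < p * β := by positivity
  have hqs : p * β < γ * p := by nlinarith
  have hsq : 0 < γ * p - p * β := sub_pos.mpr hqs
  refine ⟨T ^ (p * β) * (1 + p * β * 2 ^ p / (γ * p - p * β)), by positivity, ?_⟩
  intro v Dv hw hv hDv x₀ ρ R hρ hρR hR1
  have hae := ae_abs_le_essSup_of_memLinftyLoc hv x₀ R
  set E := essSup (fun x => |v x|) (volume.restrict (ball x₀ R)) with hE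
  have hE0 : 0 ≤ E := by
    have hne : volume.restrict (ball x₀ R) ≠ 0 := by
      rw [Ne, Measure.restrict_eq_zero]
      exact (measure_ball_pos volume x₀ (hρ.trans hρR)).ne'
    have : (ae (volume.restrict (ball x₀ R))).NeBot := ae_neBot.mpr hne
    obtain ⟨y, hy⟩ := hae.exists
    exact (abs_nonneg _).trans hy
  refine ⟨hE0, ?_⟩
  have hloc : LocallyIntegrable Dv volume := hDv.1.locallyIntegrable hp
  have hsub : ball x₀ ρ ⊆ ball x₀ R := ball_subset_ball hρR.le
  have hS : 0 ≤ besovSemi Dv γ p x₀ R ^ p := Real.rpow_nonneg (besovSemi_nonneg ..) _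
  have hN : 0 ≤ normW1p v Dv p (ball x₀ R) ^ p := by unfold normW1p; positivity
  have hd : 0 < R - ρ := sub_pos.mpr hρR
  rw [ae_restrict_iff' measurableSet_ball] at hae
  have hbound : ∀ M ∈ Ioi E, ∫⁻ x in ball x₀ ρ, ENNReal.ofReal (‖Dv x‖ ^ (p * (1 + β))) ≤
      ENNReal.ofReal (T ^ (p * β) * (1 + p * β * 2 ^ p / (γ * p - p * β)) * M ^ (p * β) *
        (besovSemi Dv γ p x₀ R ^ p +
          ((R - ρ) ^ (2 * p))⁻¹ * normW1p v Dv p (ball x₀ R) ^ p)) := by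
    intro M hM
    have hM0 : 0 < M := hE0.trans_lt hM
    have h1 := htail hp (by positivity : 0 ≤ γ * p) hw hloc hρR hS hM0
      (hae.mono fun y hy hyR => (hy hyR).trans (le_of_lt hM)) fun h hh =>
        (lintegral_mono_set hsub).trans
          (hDv.lintegral_enorm_sub_rpow_le hp0 x₀ (hh.trans_lt (by linarith)))
    have h2 := lintegral_rpow_add_le_of_tail (fun x => norm_nonneg (Dv x))
      hloc.aestronglyMeasurable.restrict.norm.aemeasurable hp0 hq hqs (by positivity)
      (by positivity) h1
    rw [mul_add, mul_one]
    refine h2.trans ?_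
    grw [lintegral_mono_set hsub, lintegral_norm_rpow_le_normW1p_rpow hp0 (v := v) hDv.1 x₀ R,
      ← ENNReal.ofReal_mul (by positivity), ← ENNReal.ofReal_add (by positivity) (by positivity)]
    exact ENNReal.ofReal_le_ofReal (rpow_scaling_le hq hqs (by nlinarith) hT hM0 hd
      (by linarith) hS hN)
  refine ge_of_tendsto (f := fun M : ℝ => ENNReal.ofReal (T ^ (p * β) *
    (1 + p * β * 2 ^ p / (γ * p - p * β)) * M ^ (p * β) * (besovSemi Dv γ p x₀ R ^ p +
      ((R - ρ) ^ (2 * p))⁻¹ * normW1p v Dv p (ball x₀ R) ^ p))) (x := 𝓝[>] E) ?_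
    (eventually_mem_nhdsWithin.mono hbound)
  refine Tendsto.mono_left (Continuous.tendsto ?_ E) nhdsWithin_le_nhds
  have := Real.continuous_rpow_const hq.le
  exact ENNReal.continuous_ofReal.comp (by fun_prop)

/-- Proposition 3.4: higher integrability of the gradient for bounded functions
with Besov gradient. -/
theorem higher_integrability_besov_gradient
    {n : ℕ} (p γ β : ℝ) (hp : 1 ≤ p) (hγ0 : 0 < γ) (hγ1 : γ < 1)
    (hβ0 : 0 < β) (hβγ : β < γ) :
    ∃ C : ℝ, 0 < C ∧
      ∀ (v : En n → ℝ) (Dv : En n → En n),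
        IsWeakGrad (Set.univ : Set (En n)) v Dv →
        MemLplocS v p (Set.univ : Set (En n)) →
        MemLplocS Dv p (Set.univ : Set (En n)) →
        MemLinftyLoc v (Set.univ : Set (En n)) →
        MemBesovLocInfty Dv γ p (Set.univ : Set (En n)) →
        MemLplocS Dv (p * (1 + β)) (Set.univ : Set (En n)) ∧
          ∀ (x₀ : En n) (ρ R : ℝ), 0 < ρ → ρ < R → R ≤ 1 →
            (∫ x in ball x₀ ρ, ‖Dv x‖ ^ (p * (1 + β))) ≤
              C * essSup (fun x => |v x|) (volume.restrict (ball x₀ R)) ^ (p * β) *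
                (besovSemi Dv γ p x₀ R ^ p +
                  ((R - ρ) ^ (2 * p))⁻¹ * normW1p v Dv p (ball x₀ R) ^ p) := by
  obtain ⟨C, hC, hmain⟩ := exists_lintegral_norm_rpow_le n hp hγ1 hβ0 hβγ
  refine ⟨C, hC, fun v Dv hw _ hDv hv hB => ⟨?_, ?_⟩⟩
  · have hmeas : AEStronglyMeasurable Dv volume := (hDv.locallyIntegrable hp).aestronglyMeasurable
    have hli : LocallyIntegrable (fun x => ‖Dv x‖ ^ (p * (1 + β))) volume := by
      refine fun x => ⟨ball x (1 / 2), ball_mem_nhds x (by norm_num), ?_, ?_⟩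
      · exact (hmeas.norm.aemeasurable.pow_const _).aestronglyMeasurable.restrict
      · rw [hasFiniteIntegral_iff_ofReal (ae_of_all _ fun x => by positivity)]
        exact (hmain hw hv hB x (by norm_num) (by norm_num : (1 / 2 : ℝ) < 1)
          le_rfl).2.trans_lt ENNReal.ofReal_lt_top
    exact fun K _ hK => ⟨hmeas.restrict, hli.integrableOn_isCompact hK⟩
  · intro x₀ ρ R hρ hρR hR
    obtain ⟨hE, hle⟩ := hmain hw hv hB x₀ hρ hρR hR
    have hS := besovSemi_nonneg Dv γ p x₀ R
    have hN : 0 ≤ normW1p v Dv p (ball x₀ R) := by unfold normW1p; positivity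
    have hd : 0 < R - ρ := sub_pos.mpr hρR
    rw [integral_eq_lintegral_of_nonneg_ae (ae_of_all _ fun x => by positivity)
      ((hDv.locallyIntegrable hp).aestronglyMeasurable.norm.aemeasurable.pow_const
        _).aestronglyMeasurable.restrict]
    exact ENNReal.toReal_le_of_le_ofReal (by positivity) hle
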